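/- arXiv:1207.2725 — 5 statements merged into one kernel-verified Lean document; each statement's English description precedes it below -/
import Mathlib

section
/- Let I ⊂ ℝ be a bounded interval and let F, m, F_h, m_h : I → [0,∞) (h ∈ ℕ) be Lebesgue measurable functions with m and each m_h integrable. Assume that liminf_{h→∞} F_h(s) ≥ F(s) for Lebesgue-a.e. s ∈ I, and that m_h converges to m weakly in L¹(I), i.e. ∫_I m_h(s) φ(s) ds → ∫_I m(s) φ(s) ds for every bounded measurable φ : I → ℝ. Then liminf_{h→∞} ∫_I F_h(s) m_h(s) ds ≥ ∫_I F(s) m(s) ds, where the integrals are taken with values in [0,∞]. -/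
open MeasureTheory Filter Topology

/-- A nonnegative bounded weight passes to the limit under convergence of integrals. -/
theorem tendsto_lintegral_mul_of_tendsto_integral {α : Type*} [MeasurableSpace α]
    {μ : Measure α} {m : α → ℝ} {mh : ℕ → α → ℝ}
    (hm : Integrable m μ) (hmh : ∀ h, Integrable (mh h) μ)
    (hm0 : 0 ≤ᵐ[μ] m) (hmh0 : ∀ h, 0 ≤ᵐ[μ] mh h)
    {g : α → ENNReal} (hg : Measurable g) {C : NNReal} (hgC : ∀ s, g s ≤ C)
    (hweak : Tendsto (fun h => ∫ s, mh h s * (g s).toReal ∂μ) atTop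
      (𝓝 (∫ s, m s * (g s).toReal ∂μ))) :
    Tendsto (fun h => ∫⁻ s, g s * ENNReal.ofReal (mh h s) ∂μ) atTop
      (𝓝 (∫⁻ s, g s * ENNReal.ofReal (m s) ∂μ)) := by
  have key : ∀ f : α → ℝ, Integrable f μ → 0 ≤ᵐ[μ] f →
      ∫⁻ s, g s * ENNReal.ofReal (f s) ∂μ = ENNReal.ofReal (∫ s, f s * (g s).toReal ∂μ) := by
    intro f hf hf0
    rw [ofReal_integral_eq_lintegral_ofReal]
    · refine lintegral_congr_ae ?_
      filter_upwards [hf0] with s hs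
      rw [ENNReal.ofReal_mul hs,
        ENNReal.ofReal_toReal (ne_top_of_le_ne_top ENNReal.coe_ne_top (hgC s)), mul_comm]
    · refine hf.mul_bdd (c := (C : ℝ)) hg.ennreal_toReal.aestronglyMeasurable
        (ae_of_all _ fun s => ?_)
      rw [Real.norm_of_nonneg ENNReal.toReal_nonneg]
      exact ENNReal.toReal_mono ENNReal.coe_ne_top (hgC s)
    · filter_upwards [hf0] with s hs
      exact mul_nonneg hs ENNReal.toReal_nonneg
  simp_rw [key m hm hm0, fun h => key (mh h) (hmh h) (hmh0 h)]
  exact (ENNReal.continuous_ofReal.tendsto _).comp hweak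

/-- The tail infima of a sequence, truncated at height `N`, increase to its `liminf`. -/
theorem iSup_iInf_min_natCast_eq_liminf (u : ℕ → ENNReal) :
    ⨆ N : ℕ, min (⨅ i, u (i + N)) (N : ENNReal) = liminf u atTop := by
  have hmono : Monotone fun N : ℕ => ⨅ i, u (i + N) := fun M N hMN =>
    le_iInf fun i => (iInf_le _ (i + (N - M))).trans_eq (by congr 1; omega)
  rw [liminf_eq_iSup_iInf_of_nat', iSup_inf_of_monotone hmono Nat.mono_cast,
    ENNReal.iSup_natCast, inf_top_eq]

/-- If `F_h ≥ F` in the a.e.-liminf sense and `m_h ⇀ m` weakly in `L¹(I)`,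
then `liminf ∫ F_h m_h ≥ ∫ F m` (integrals of nonnegative functions in `[0,∞]`). -/
theorem liminf_integral_mul_ge
    (I : Set ℝ) (hIconn : I.OrdConnected) (hIbdd : Bornology.IsBounded I)
    (F m : ℝ → ℝ) (Fh mh : ℕ → ℝ → ℝ)
    (hFmeas : Measurable F) (hmmeas : Measurable m)
    (hFhmeas : ∀ h, Measurable (Fh h)) (hmhmeas : ∀ h, Measurable (mh h))
    (hFnn : ∀ s ∈ I, 0 ≤ F s) (hmnn : ∀ s ∈ I, 0 ≤ m s)
    (hFhnn : ∀ h, ∀ s ∈ I, 0 ≤ Fh h s) (hmhnn : ∀ h, ∀ s ∈ I, 0 ≤ mh h s)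
    (hmint : IntegrableOn m I) (hmhint : ∀ h, IntegrableOn (mh h) I)
    (hliminf : ∀ᵐ s ∂(volume.restrict I),
      ENNReal.ofReal (F s) ≤ Filter.liminf (fun h => ENNReal.ofReal (Fh h s)) atTop)
    (hweak : ∀ φ : ℝ → ℝ, Measurable φ → (∃ C : ℝ, ∀ s, |φ s| ≤ C) →
      Tendsto (fun h => ∫ s in I, mh h s * φ s) atTop (𝓝 (∫ s in I, m s * φ s))) :
    ∫⁻ s in I, ENNReal.ofReal (F s * m s) ≤
      Filter.liminf (fun h => ∫⁻ s in I, ENNReal.ofReal (Fh h s * mh h s)) atTop := by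
  have hI : MeasurableSet I := hIconn.measurableSet
  have hm0 : 0 ≤ᵐ[volume.restrict I] m := ae_restrict_of_forall_mem hI hmnn
  have hmh0 : ∀ h, 0 ≤ᵐ[volume.restrict I] mh h := fun h =>
    ae_restrict_of_forall_mem hI (hmhnn h)
  let g : ℕ → ℝ → ENNReal := fun N s =>
    min (⨅ i, ENNReal.ofReal (Fh (i + N) s)) (N : ENNReal)
  have hgmeas : ∀ N, Measurable (g N) := fun N =>
    (Measurable.iInf fun i => (hFhmeas (i + N)).ennreal_ofReal).min measurable_const
  have hgN : ∀ N s, g N s ≤ ((N : NNReal) : ENNReal) := fun N s => by simp [g]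
  have hgmono : Monotone g := fun M N hMN s =>
    min_le_min (le_iInf fun i => (iInf_le _ (i + (N - M))).trans_eq
      (by rw [show i + (N - M) + M = i + N by omega])) (Nat.cast_le.2 hMN)
  have hstep : ∀ N, ∫⁻ s in I, g N s * ENNReal.ofReal (m s) ≤
      liminf (fun h => ∫⁻ s in I, ENNReal.ofReal (Fh h s * mh h s)) atTop := by
    intro N
    have hlim := tendsto_lintegral_mul_of_tendsto_integral hmint hmhint hm0 hmh0
      (hgmeas N) (hgN N) (hweak _ (hgmeas N).ennreal_toReal ⟨N, fun s => by
        rw [abs_of_nonneg ENNReal.toReal_nonneg]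
        simpa using ENNReal.toReal_mono ENNReal.coe_ne_top (hgN N s)⟩)
    rw [← hlim.liminf_eq]
    refine liminf_le_liminf ?_
    filter_upwards [eventually_ge_atTop N] with h hh
    refine setLIntegral_mono' hI fun s hs => ?_
    rw [ENNReal.ofReal_mul (hFhnn h s hs)]
    gcongr
    refine (min_le_left _ _).trans ((iInf_le _ (h - N)).trans_eq ?_)
    rw [Nat.sub_add_cancel hh]
  calc ∫⁻ s in I, ENNReal.ofReal (F s * m s)
      ≤ ∫⁻ s in I, ⨆ N, g N s * ENNReal.ofReal (m s) := by
        refine lintegral_mono_ae ?_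
        filter_upwards [hliminf, ae_restrict_mem hI] with s hs hsI
        rw [← ENNReal.iSup_mul, iSup_iInf_min_natCast_eq_liminf fun h => ENNReal.ofReal (Fh h s),
          ENNReal.ofReal_mul (hFnn s hsI)]
        gcongr
    _ = ⨆ N, ∫⁻ s in I, g N s * ENNReal.ofReal (m s) :=
        lintegral_iSup (fun N => (hgmeas N).mul hmmeas.ennreal_ofReal)
          fun M N hMN s => mul_le_mul_left (hgmono hMN s) _
    _ ≤ _ := iSup_le hstep
end

section
/- Let ψ_h (h ∈ ℕ) and ψ be metric dissipation functions. Then ψ_h(v) → ψ(v) as h → ∞ for every v ∈ [0,∞) if and only if ψ_h Γ-converges to ψ on [0,∞), i.e.: (i) for every v ∈ [0,∞) and every sequence v_h → v in [0,∞) one has liminf_{h→∞} ψ_h(v_h) ≥ ψ(v), and (ii) for every v ∈ [0,∞) there exists a sequence v_h → v in [0,∞) with limsup_{h→∞} ψ_h(v_h) ≤ ψ(v). -/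
open Filter Topology

/-- A metric dissipation function: `ψ : [0,∞) → [0,∞)` is convex, vanishes at `0`,
and `ψ(v)/v → L ∈ (0,∞]` as `v → ∞`. -/
def IsDissipation (ψ : ℝ → ℝ) (L : ENNReal) : Prop :=
  ConvexOn ℝ (Set.Ici 0) ψ ∧ ψ 0 = 0 ∧ (∀ v ∈ Set.Ici (0:ℝ), 0 ≤ ψ v) ∧ 0 < L ∧
    Tendsto (fun v : ℝ => ENNReal.ofReal (ψ v / v)) atTop (𝓝 L)

namespace IsDissipation

variable {φ : ℝ → ℝ} {L : ENNReal}

theorem monotoneOn (hφ : IsDissipation φ L) : MonotoneOn φ (Set.Ici 0) := by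
  obtain ⟨hconv, h0, hnonneg, -, -⟩ := hφ
  intro x hx y hy hxy
  have hx' : (0 : ℝ) ≤ x := hx
  rcases hxy.eq_or_lt with rfl | hlt
  · exact le_rfl
  have hy' : 0 < y := hx'.trans_lt hlt
  have hle := hconv.2 (Set.self_mem_Ici (a := (0 : ℝ))) hy
    (sub_nonneg.2 ((div_le_one hy').2 hxy)) (div_nonneg hx' hy'.le) (sub_add_cancel 1 (x / y))
  simp only [smul_eq_mul, mul_zero, zero_add, h0, div_mul_cancel₀ x hy'.ne'] at hle
  exact hle.trans (mul_le_of_le_one_left (hnonneg y hy) ((div_le_one hy').2 hxy))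

theorem continuousAt (hφ : IsDissipation φ L) {v : ℝ} (hv : 0 < v) : ContinuousAt φ v := by
  have hcont := hφ.1.continuousOn_interior
  rw [interior_Ici] at hcont
  exact hcont.continuousAt (Ioi_mem_nhds hv)

theorem tendsto_ofReal (hφ : IsDissipation φ L) {v : ℝ} (hv : 0 < v) :
    Tendsto (fun w => ENNReal.ofReal (φ w)) (𝓝 v) (𝓝 (ENNReal.ofReal (φ v))) :=
  ENNReal.tendsto_ofReal (hφ.continuousAt hv)

end IsDissipation

/-- For metric dissipation functions, pointwise convergence
`ψ_h(v) → ψ(v)` on `[0,∞)` is equivalent to Γ-convergence on `[0,∞)`: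
the `Γ-liminf` inequality along arbitrary nonnegative sequences `v_h → v`, together with
the existence of a recovery sequence for every `v ∈ [0,∞)`. -/
theorem pointwise_iff_gammaConvergence
    (ψh : ℕ → ℝ → ℝ) (Lh : ℕ → ENNReal) (ψ : ℝ → ℝ) (L : ENNReal)
    (hψh : ∀ h, IsDissipation (ψh h) (Lh h)) (hψ : IsDissipation ψ L) :
    (∀ v : ℝ, 0 ≤ v → Tendsto (fun h => ψh h v) atTop (𝓝 (ψ v))) ↔
      ((∀ v : ℝ, 0 ≤ v → ∀ vh : ℕ → ℝ, (∀ h, 0 ≤ vh h) → Tendsto vh atTop (𝓝 v) →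
          ENNReal.ofReal (ψ v) ≤ liminf (fun h => ENNReal.ofReal (ψh h (vh h))) atTop) ∧
        (∀ v : ℝ, 0 ≤ v → ∃ vh : ℕ → ℝ, (∀ h, 0 ≤ vh h) ∧ Tendsto vh atTop (𝓝 v) ∧
          limsup (fun h => ENNReal.ofReal (ψh h (vh h))) atTop ≤ ENNReal.ofReal (ψ v))) := by
  constructor
  · intro hpt
    refine ⟨fun v hv vh hvh hlim => ?_, fun v hv => ⟨fun _ => v, fun _ => hv,
      tendsto_const_nhds, (ENNReal.tendsto_ofReal (hpt v hv)).limsup_eq.le⟩⟩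
    rcases hv.eq_or_lt with rfl | hv
    · simp [hψ.2.1]
    refine le_of_tendsto ((hψ.tendsto_ofReal hv).mono_left (nhdsWithin_le_nhds (s := Set.Iio v))) ?_
    filter_upwards [Ioo_mem_nhdsLT hv] with w hw
    rw [← (ENNReal.tendsto_ofReal (hpt w hw.1.le)).liminf_eq]
    refine liminf_le_liminf ?_
    filter_upwards [hlim.eventually (lt_mem_nhds hw.2)] with h hh
    exact ENNReal.ofReal_le_ofReal ((hψh h).monotoneOn hw.1.le (hvh h) hh.le)
  · rintro ⟨hinf, hsup⟩ v hv
    rcases hv.eq_or_lt with rfl | hv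
    · simp [hψ.2.1, (hψh _).2.1]
    have hlimsup : limsup (fun h => ENNReal.ofReal (ψh h v)) atTop ≤ ENNReal.ofReal (ψ v) := by
      refine ge_of_tendsto
        ((hψ.tendsto_ofReal hv).mono_left (nhdsWithin_le_nhds (s := Set.Ioi v))) ?_
      filter_upwards [self_mem_nhdsWithin] with u hu
      obtain ⟨uh, huh, hlim, hle⟩ := hsup u (hv.trans hu).le
      refine le_trans (limsup_le_limsup ?_) hle
      filter_upwards [hlim.eventually (lt_mem_nhds hu)] with h hh
      exact ENNReal.ofReal_le_ofReal ((hψh h).monotoneOn hv.le (huh h) hh.le)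
    have htendsto := tendsto_of_le_liminf_of_limsup_le
      (hinf v hv.le (fun _ => v) (fun _ => hv.le) tendsto_const_nhds) hlimsup
    have hreal := (ENNReal.tendsto_toReal ENNReal.ofReal_ne_top).comp htendsto
    simpa only [Function.comp_def, ENNReal.toReal_ofReal ((hψh _).2.2.1 v hv.le),
      ENNReal.toReal_ofReal (hψ.2.2.1 v hv.le)] using hreal
end

section
/- Let ψ_h (h ∈ ℕ) and ψ be metric dissipation functions such that ψ_h(v) → ψ(v) as h → ∞ for every v ∈ [0,∞), and let L := lim_{v→∞} ψ(v)/v ∈ (0,∞]. Then for every f ∈ [0,∞) with f < L one has ψ*(f) < ∞ and lim_{h→∞} ψ_h*(f) = ψ*(f). -/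
open Filter Topology

/-- The conjugate `ψ*(f) = sup_{v ≥ 0} (f·v − ψ(v)) ∈ [0,∞]`. -/
noncomputable def conj (ψ : ℝ → ℝ) (f : ℝ) : ENNReal :=
  ⨆ v ∈ Set.Ici (0:ℝ), ENNReal.ofReal (f * v - ψ v)

namespace IsDissipation

variable {ψ : ℝ → ℝ} {L : ENNReal}

/-- The difference quotient at `0` is monotone, in division-free form. -/
theorem mul_le_mul (h : IsDissipation ψ L) {x y : ℝ} (hx : 0 ≤ x) (hxy : x ≤ y) :
    y * ψ x ≤ x * ψ y := by
  obtain ⟨hc, h0, -, -, -⟩ := h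
  rcases (hx.trans hxy).eq_or_lt with rfl | hy
  · simp [le_antisymm hxy hx]
  have key := hc.2 (Set.mem_Ici.2 hy.le) (Set.mem_Ici.2 le_rfl) (div_nonneg hx hy.le)
    (sub_nonneg.2 ((div_le_one hy).2 hxy)) (by ring)
  simp only [smul_eq_mul, mul_zero, add_zero, h0, div_mul_cancel₀ x hy.ne'] at key
  calc y * ψ x ≤ y * (x / y * ψ y) := mul_le_mul_of_nonneg_left key hy.le
    _ = x * ψ y := by field_simp

theorem mono (h : IsDissipation ψ L) {x y : ℝ} (hx : 0 ≤ x) (hxy : x ≤ y) : ψ x ≤ ψ y := by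
  rcases (hx.trans hxy).eq_or_lt with rfl | hy
  · rw [le_antisymm hxy hx]
  have hψy : 0 ≤ ψ y := h.2.2.1 y hy.le
  exact le_of_mul_le_mul_left
    ((h.mul_le_mul hx hxy).trans (mul_le_mul_of_nonneg_right hxy hψy)) hy

theorem exists_mul_lt (h : IsDissipation ψ L) {f : ℝ} (hf : 0 ≤ f) (hfL : ENNReal.ofReal f < L) :
    ∃ V, 0 < V ∧ f * V < ψ V := by
  obtain ⟨V, hV, hV0⟩ :=
    ((h.2.2.2.2.eventually (lt_mem_nhds hfL)).and (eventually_gt_atTop 0)).exists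
  exact ⟨V, hV0, (lt_div_iff₀ hV0).1 ((ENNReal.ofReal_lt_ofReal_iff_of_nonneg hf).1 hV)⟩

theorem mul_lt_of_le (h : IsDissipation ψ L) {f V v : ℝ} (hV : 0 < V) (hfV : f * V < ψ V)
    (hv : V ≤ v) : f * v < ψ v := by
  have hlt : v * (f * V) < v * ψ V := mul_lt_mul_of_pos_left hfV (hV.trans_le hv)
  have hle := h.mul_le_mul hV.le hv
  exact lt_of_mul_lt_mul_left (by linarith : V * (f * v) < V * ψ v) hV.le

theorem conj_lt_top (h : IsDissipation ψ L) {f : ℝ} (hf : 0 ≤ f) (hfL : ENNReal.ofReal f < L) :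
    conj ψ f < ⊤ := by
  obtain ⟨V, hV, hfV⟩ := h.exists_mul_lt hf hfL
  refine lt_of_le_of_lt (iSup₂_le fun v hv => ENNReal.ofReal_le_ofReal ?_)
    (ENNReal.ofReal_lt_top (r := f * V))
  have hψv := h.2.2.1 v hv
  rcases le_total v V with hvV | hvV
  · linarith [mul_le_mul_of_nonneg_left hvV hf]
  · linarith [h.mul_lt_of_le hV hfV hvV, mul_nonneg hf hV.le]

end IsDissipation

theorem ofReal_le_conj (ψ : ℝ → ℝ) (f : ℝ) {v : ℝ} (hv : 0 ≤ v) :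
    ENNReal.ofReal (f * v - ψ v) ≤ conj ψ f :=
  le_iSup₂ (f := fun v (_ : v ∈ Set.Ici (0 : ℝ)) => ENNReal.ofReal (f * v - ψ v)) v hv

/-- Values on a grid of step `δ` control the conjugate up to an error `f * δ`. -/
theorem IsDissipation.conj_le_of_grid {ψ : ℝ → ℝ} {L : ENNReal} (h : IsDissipation ψ L)
    {f V δ r : ℝ} (hf : 0 ≤ f) (hV : 0 < V) (hfV : f * V < ψ V) (hδ : 0 < δ) (hr : 0 ≤ r)
    (hgrid : ∀ i ≤ ⌊V / δ⌋₊, f * (i * δ) - ψ (i * δ) + f * δ ≤ r) :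
    conj ψ f ≤ ENNReal.ofReal r := by
  refine iSup₂_le fun v (hv : 0 ≤ v) => ENNReal.ofReal_le_ofReal ?_
  rcases le_total V v with hvV | hvV
  · linarith [h.mul_lt_of_le hV hfV hvV]
  have hi := hgrid ⌊v / δ⌋₊ (Nat.floor_mono (div_le_div_of_nonneg_right hvV hδ.le))
  have hlow : (⌊v / δ⌋₊ : ℝ) * δ ≤ v :=
    (le_div_iff₀ hδ).1 (Nat.floor_le (div_nonneg hv hδ.le))
  have hupp : v < (⌊v / δ⌋₊ + 1 : ℝ) * δ := (div_lt_iff₀ hδ).1 (Nat.lt_floor_add_one _)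
  have hmono := h.mono (by positivity) hlow
  linarith [mul_le_mul_of_nonneg_left hupp.le hf]

/-- If the metric dissipation functions `ψ_h` converge pointwise on
`[0,∞)` to the metric dissipation function `ψ` with `L = lim_{v→∞} ψ(v)/v ∈ (0,∞]`,
then for every `f ∈ [0,∞)` with `f < L` one has `ψ*(f) < ∞` and `ψ_h*(f) → ψ*(f)`. -/
theorem conj_tendsto_of_pointwise
    (ψh : ℕ → ℝ → ℝ) (Lh : ℕ → ENNReal) (ψ : ℝ → ℝ) (L : ENNReal)
    (hψh : ∀ h, IsDissipation (ψh h) (Lh h)) (hψ : IsDissipation ψ L)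
    (hconv : ∀ v : ℝ, 0 ≤ v → Tendsto (fun h => ψh h v) atTop (𝓝 (ψ v))) :
    ∀ f : ℝ, 0 ≤ f → ENNReal.ofReal f < L →
      conj ψ f < ⊤ ∧ Tendsto (fun h => conj (ψh h) f) atTop (𝓝 (conj ψ f)) := by
  intro f hf hfL
  have hfin := hψ.conj_lt_top hf hfL
  refine ⟨hfin, tendsto_order.2 ⟨fun a ha => ?_, fun b hb => ?_⟩⟩
  · simp only [conj, lt_iSup_iff] at ha
    obtain ⟨v, hv, hav⟩ := ha
    have hlim : Tendsto (fun h => ENNReal.ofReal (f * v - ψh h v)) atTop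
        (𝓝 (ENNReal.ofReal (f * v - ψ v))) :=
      ENNReal.tendsto_ofReal (tendsto_const_nhds.sub (hconv v hv))
    filter_upwards [hlim.eventually (lt_mem_nhds hav)] with h hh
    exact hh.trans_le (ofReal_le_conj _ _ hv)
  · obtain ⟨r, hr, hrb⟩ := ENNReal.lt_iff_exists_nnreal_btwn.1 hb
    obtain ⟨V, hV, hfV⟩ := hψ.exists_mul_lt hf hfL
    have hcr : (conj ψ f).toReal < r := ENNReal.toReal_lt_of_lt_ofReal (by simpa using hr)
    obtain ⟨δ, hδ, hfδ⟩ : ∃ δ : ℝ, 0 < δ ∧ f * δ < r - (conj ψ f).toReal := by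
      have hpos := sub_pos.2 hcr
      refine ⟨(r - (conj ψ f).toReal) / (f + 1), by positivity, ?_⟩
      rw [mul_div_assoc', div_lt_iff₀ (by positivity)]
      linarith
    have hgrid : ∀ᶠ h in atTop, ∀ i ∈ Set.Iic ⌊V / δ⌋₊,
        f * (i * δ) - ψh h (i * δ) + f * δ < r := by
      refine (eventually_all_finite (Set.finite_Iic _)).2 fun i _ => ?_
      have hiδ : 0 ≤ (i : ℝ) * δ := by positivity
      have hlim := ((tendsto_const_nhds (x := f * (i * δ))).sub (hconv _ hiδ)).add_const (f * δ)
      refine hlim.eventually (gt_mem_nhds ?_)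
      have hle := (ENNReal.ofReal_le_iff_le_toReal hfin.ne).1 (ofReal_le_conj ψ f hiδ)
      linarith
    filter_upwards [hgrid, (hconv V hV.le).eventually (lt_mem_nhds hfV)] with h hh hhV
    refine lt_of_le_of_lt ((hψh h).conj_le_of_grid hf hV hhV hδ r.2 fun i hi => (hh i hi).le) ?_
    simpa using hrb
end

section
/- Let ψ be a metric dissipation function with L-linear growth, i.e. L := lim_{v→∞} ψ(v)/v ∈ (0,∞), and let ψ* be its conjugate. Then for every v ∈ [0,∞), ψ(v) = sup_{0 < f < L} ( f·v − ψ*(f) ). -/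
open Filter Topology

/-- A convex function on a set of reals has a supporting line at each interior point. -/
lemma ConvexOn.exists_supporting_line {S : Set ℝ} {ψ : ℝ → ℝ} (hψ : ConvexOn ℝ S ψ) {v : ℝ}
    (hv : v ∈ interior S) : ∃ g : ℝ, ∀ w ∈ S, ψ v + g * (w - v) ≤ ψ w := by
  refine ⟨derivWithin ψ (Set.Ioi v) v, fun w hw => ?_⟩
  rcases lt_trichotomy v w with h | rfl | h
  · have := hψ.rightDeriv_le_slope_of_mem_interior hv hw h
    rw [slope_def_field, le_div_iff₀ (sub_pos.2 h)] at this
    linarith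
  · simp
  · have := (hψ.slope_le_leftDeriv_of_mem_interior hw hv h).trans
      (hψ.leftDeriv_le_rightDeriv_of_mem_interior hv)
    rw [slope_def_field, div_le_iff₀ (sub_pos.2 h)] at this
    linarith

/-- The slope of an affine minorant of `ψ` is at most the growth rate of `ψ` at infinity. -/
lemma slope_le_of_tendsto_div {ψ : ℝ → ℝ} {L a g : ℝ} (hL : 0 ≤ L)
    (hlim : Tendsto (fun w : ℝ => ENNReal.ofReal (ψ w / w)) atTop (𝓝 (ENNReal.ofReal L)))
    (h : ∀ w : ℝ, 0 ≤ w → a + g * w ≤ ψ w) : g ≤ L := by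
  have hinv : Tendsto (fun w : ℝ => ENNReal.ofReal (a * w⁻¹ + g)) atTop
      (𝓝 (ENNReal.ofReal g)) := by
    refine ENNReal.tendsto_ofReal ?_
    simpa using (tendsto_inv_atTop_zero.const_mul a).add_const g
  refine (ENNReal.ofReal_le_ofReal_iff hL).1 (le_of_tendsto_of_tendsto hinv hlim ?_)
  filter_upwards [eventually_gt_atTop 0] with w hw
  refine ENNReal.ofReal_le_ofReal ?_
  rw [le_div_iff₀ hw, add_mul, mul_assoc, inv_mul_cancel₀ hw.ne', mul_one]
  exact h w hw.le

/-- The Fenchel–Young inequality, in subtractive form. -/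
lemma ofReal_mul_sub_conj_le (ψ : ℝ → ℝ) (f : ℝ) {v : ℝ} (hv : 0 ≤ v) :
    ENNReal.ofReal (f * v) - conj ψ f ≤ ENNReal.ofReal (ψ v) := by
  rw [tsub_le_iff_right]
  calc ENNReal.ofReal (f * v) = ENNReal.ofReal (ψ v + (f * v - ψ v)) := by ring_nf
    _ ≤ ENNReal.ofReal (ψ v) + ENNReal.ofReal (f * v - ψ v) := ENNReal.ofReal_add_le
    _ ≤ ENNReal.ofReal (ψ v) + conj ψ f := by
      gcongr
      exact le_iSup₂_of_le (f := fun v (_ : v ∈ Set.Ici (0:ℝ)) => ENNReal.ofReal (f * v - ψ v))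
        v hv le_rfl

/-- If `g` is the slope of a supporting line of `ψ ≥ 0` at `v`, then for `t ∈ [0,1]` the conjugate
of `ψ` at `t g` is at most `t` times its value `g v - ψ v` at `g`. -/
lemma conj_mul_le {ψ : ℝ → ℝ} (hnn : ∀ w ∈ Set.Ici (0:ℝ), 0 ≤ ψ w) {v g t : ℝ}
    (hg : ∀ w ∈ Set.Ici (0:ℝ), ψ v + g * (w - v) ≤ ψ w) (ht0 : 0 ≤ t) (ht1 : t ≤ 1) :
    conj ψ (t * g) ≤ ENNReal.ofReal (t * (g * v - ψ v)) := by
  refine iSup₂_le fun w hw => ENNReal.ofReal_le_ofReal ?_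
  have hscaled := mul_le_mul_of_nonneg_left (hg w hw) ht0
  have hshrink := mul_le_mul_of_nonneg_right ht1 (hnn w hw)
  linarith

/-- If `ψ` is a metric dissipation function with `L`-linear growth,
`L = lim_{v→∞} ψ(v)/v ∈ (0,∞)`, then the duality formula
`ψ(v) = sup_{0 < f < L} (f·v − ψ*(f))` holds for every `v ∈ [0,∞)`
(with truncated subtraction in `[0,∞]`). -/
theorem duality_formula_linear_growth
    (ψ : ℝ → ℝ) (L : ℝ) (hL : 0 < L) (hψ : IsDissipation ψ (ENNReal.ofReal L)) :
    ∀ v : ℝ, 0 ≤ v →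
      ENNReal.ofReal (ψ v) =
        ⨆ f ∈ Set.Ioo (0:ℝ) L, (ENNReal.ofReal (f * v) - conj ψ f) := by
  intro v hv
  obtain ⟨hconv, h0, hnn, -, hlim⟩ := hψ
  refine le_antisymm ?_ (iSup₂_le fun f _ => ofReal_mul_sub_conj_le ψ f hv)
  rcases (hnn v hv).eq_or_lt with hz | hpos
  · simp [← hz]
  have hv0 : 0 < v := hv.lt_of_ne fun h => by simp [← h, h0] at hpos
  obtain ⟨g, hg⟩ := hconv.exists_supporting_line (v := v) (by simpa using hv0)
  have hgv : ψ v ≤ g * v := by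
    have := hg 0 Set.self_mem_Ici
    rw [h0] at this
    linarith
  have hg0 : 0 < g := pos_of_mul_pos_left (hpos.trans_le hgv) hv
  have hgL : g ≤ L := slope_le_of_tendsto_div (a := ψ v - g * v) hL.le hlim fun w hw => by
    linarith [hg w hw]
  have htend : Tendsto (fun t : ℝ => ENNReal.ofReal (t * ψ v)) (𝓝[<] 1)
      (𝓝 (ENNReal.ofReal (ψ v))) := by
    refine ENNReal.tendsto_ofReal (tendsto_nhdsWithin_of_tendsto_nhds ?_)
    simpa using (tendsto_id (α := ℝ) (x := 𝓝 1)).mul_const (ψ v)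
  refine le_of_tendsto htend ?_
  filter_upwards [Ioo_mem_nhdsLT (zero_lt_one' ℝ)] with t ⟨ht0, ht1⟩
  have hmem : t * g ∈ Set.Ioo (0:ℝ) L :=
    ⟨mul_pos ht0 hg0, (mul_lt_of_lt_one_left hg0 ht1).trans_le hgL⟩
  refine le_iSup₂_of_le (t * g) hmem ?_
  calc ENNReal.ofReal (t * ψ v)
      = ENNReal.ofReal (t * g * v) - ENNReal.ofReal (t * (g * v - ψ v)) := by
        rw [← ENNReal.ofReal_sub _ (mul_nonneg ht0.le (sub_nonneg.2 hgv))]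
        ring_nf
    _ ≤ ENNReal.ofReal (t * g * v) - conj ψ (t * g) :=
        tsub_le_tsub_left (conj_mul_le hnn hg ht0.le ht1.le) _
end

section
/- Let t₀ < t₁ be real numbers, let ψ : [0,∞) → [0,∞) be convex and nondecreasing with ψ(0) = 0, let g : (t₀,t₁) → [0,∞) be Lebesgue integrable, and let ν be a finite nonnegative Borel measure on [t₀,t₁]. Assume that for every t ∈ [t₀,t₁) and every ε ∈ (0, t₁ − t], ψ( (1/ε) ∫_t^{t+ε} g(r) dr ) ≤ (1/ε) ν([t, t+ε]). Then ∫_{t₀}^{t₁} ψ(g(t)) dt ≤ ν([t₀,t₁]). -/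
open MeasureTheory Filter Topology

/-- The intervals `[t, t + ε]` shrink to `t` along the Vitali family as `ε → 0⁺`. -/
theorem tendsto_Icc_add_vitaliFamily (t : ℝ) :
    Tendsto (fun ε : ℝ => Set.Icc t (t + ε)) (𝓝[>] 0)
      ((IsUnifLocDoublingMeasure.vitaliFamily (volume : Measure ℝ) 1).filterAt t) := by
  have hshift : Tendsto (fun ε : ℝ => t + ε) (𝓝[>] 0) (𝓝[>] t) := by
    simp [Tendsto]
  exact (Real.tendsto_Icc_vitaliFamily_right t).comp hshift

/-- The averages of a locally integrable function over `[t, t + ε]` converge almost everywhere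
to the function as `ε → 0⁺`. -/
theorem ae_tendsto_right_average {f : ℝ → ℝ} (hf : LocallyIntegrable f) :
    ∀ᵐ t : ℝ, Tendsto (fun ε : ℝ => (1 / ε) * ∫ r in t..(t + ε), f r) (𝓝[>] 0) (𝓝 (f t)) := by
  filter_upwards [(IsUnifLocDoublingMeasure.vitaliFamily (volume : Measure ℝ) 1).ae_tendsto_average
    hf] with t ht
  refine (ht.comp (tendsto_Icc_add_vitaliFamily t)).congr' ?_
  filter_upwards [self_mem_nhdsWithin] with ε hε
  have hε : 0 < ε := hε
  simp [setAverage_eq, integral_Icc_eq_integral_Ioc,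
    intervalIntegral.integral_of_le (le_add_of_nonneg_right hε.le), hε.le]

/-- The right difference quotients `ν [t, t + ε] / ε` converge almost everywhere to the
Lebesgue density of `ν` as `ε → 0⁺`. -/
theorem ae_tendsto_right_rnDeriv (ν : Measure ℝ) [IsLocallyFiniteMeasure ν] :
    ∀ᵐ t : ℝ, Tendsto (fun ε : ℝ => ν (Set.Icc t (t + ε)) / ENNReal.ofReal ε) (𝓝[>] 0)
      (𝓝 (ν.rnDeriv volume t)) := by
  filter_upwards [(IsUnifLocDoublingMeasure.vitaliFamily (volume : Measure ℝ) 1).ae_tendsto_rnDeriv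
    ν] with t ht
  refine (ht.comp (tendsto_Icc_add_vitaliFamily t)).congr fun ε => ?_
  simp

/-- A Jensen-type comparison: if `ψ : [0,∞) → [0,∞)` is convex and
nondecreasing with `ψ(0)=0`, `g ≥ 0` is integrable on `(t₀,t₁)`, `ν` is a finite Borel
measure, and `ψ` of the averages of `g` over `[t,t+ε]` is bounded by the corresponding
averages of `ν`, then `∫_{t₀}^{t₁} ψ(g(t)) dt ≤ ν([t₀,t₁])`. -/
theorem lintegral_comp_le_of_average_bound
    (t₀ t₁ : ℝ) (h01 : t₀ < t₁)
    (ψ : ℝ → ℝ) (hconv : ConvexOn ℝ (Set.Ici 0) ψ) (hmono : MonotoneOn ψ (Set.Ici 0))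
    (h0 : ψ 0 = 0) (hnn : ∀ v ∈ Set.Ici (0:ℝ), 0 ≤ ψ v)
    (g : ℝ → ℝ) (hgint : IntegrableOn g (Set.Ioo t₀ t₁))
    (hgnn : ∀ t ∈ Set.Ioo t₀ t₁, 0 ≤ g t)
    (ν : Measure ℝ) [IsFiniteMeasure ν]
    (hyp : ∀ t ∈ Set.Ico t₀ t₁, ∀ ε : ℝ, 0 < ε → ε ≤ t₁ - t →
      ENNReal.ofReal (ψ ((1 / ε) * ∫ r in t..(t + ε), g r)) ≤
        ν (Set.Icc t (t + ε)) / ENNReal.ofReal ε) :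
    ∫⁻ t in Set.Ioo t₀ t₁, ENNReal.ofReal (ψ (g t)) ≤ ν (Set.Icc t₀ t₁) := by
  have hle : ∀ᵐ t ∂volume.restrict (Set.Ioo t₀ t₁),
      ENNReal.ofReal (ψ (g t)) ≤ ν.rnDeriv volume t := by
    rw [ae_restrict_iff' measurableSet_Ioo]
    filter_upwards [ae_tendsto_right_rnDeriv ν, ae_tendsto_right_average
      (hgint.integrable_indicator measurableSet_Ioo).locallyIntegrable] with t hν hg ht
    rcases (hgnn t ht).eq_or_lt with hgt | hgt
    · simp [← hgt, h0]
    rw [Set.indicator_of_mem ht] at hg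
    have hψ : ContinuousAt ψ (g t) := by
      have hcont := hconv.continuousOn_interior
      rw [interior_Ici] at hcont
      exact hcont.continuousAt (Ioi_mem_nhds hgt)
    refine le_of_tendsto_of_tendsto
      ((ENNReal.continuous_ofReal.tendsto _).comp (hψ.tendsto.comp hg)) hν ?_
    filter_upwards [Ioo_mem_nhdsGT (sub_pos.2 ht.2)] with ε hε
    refine le_of_eq_of_le ?_ (hyp t ⟨ht.1.le, ht.2⟩ ε hε.1 hε.2.le)
    simp only [Function.comp_apply]
    congr 3
    refine intervalIntegral.integral_congr fun r hr => ?_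
    rw [Set.uIcc_of_le (by linarith [hε.1])] at hr
    have hmem : r ∈ Set.Ioo t₀ t₁ := ⟨ht.1.trans_le hr.1, by linarith [hr.2, hε.2]⟩
    exact Set.indicator_of_mem hmem g
  calc ∫⁻ t in Set.Ioo t₀ t₁, ENNReal.ofReal (ψ (g t))
      ≤ ∫⁻ t in Set.Ioo t₀ t₁, ν.rnDeriv volume t := lintegral_mono_ae hle
    _ ≤ ν (Set.Ioo t₀ t₁) := Measure.setLIntegral_rnDeriv_le _
    _ ≤ ν (Set.Icc t₀ t₁) := measure_mono Set.Ioo_subset_Icc_self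
end
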